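/- arXiv:1711.03627 — 2 statements merged into one kernel-verified Lean document; each statement's English description precedes it below -/
import Mathlib

section
/- Let X be a transitive locally compact two-sided countable Markov shift, and let φ⁺ : X⁺ → ℝ and φ⁻ : X⁻ → ℝ have summable variations and be cohomologous via a uniformly continuous transfer function ψ : X → ℝ. Then φ⁺ is λ-transient if and only if φ⁻ is λ-transient, i.e., Σ_n λ⁻ⁿ (L_{φ⁺}ⁿ f)(x) < ∞ for some (all) non-zero f ∈ C_c⁺(X⁺), x ∈ X⁺ iff the analogous sums for L_{φ⁻} on X⁻ are finite. -/
open MeasureTheory ENNReal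

variable {S : Type*}

/-- The positive one-sided topological Markov shift. -/
abbrev MShift (Adj : S → S → Prop) : Type _ :=
  {x : ℕ → S // ∀ i, Adj (x i) (x (i + 1))}

/-- The left shift on the positive one-sided shift. -/
def shiftMap (Adj : S → S → Prop) (x : MShift Adj) : MShift Adj :=
  ⟨fun i => x.1 (i + 1), fun i => x.2 (i + 1)⟩

/-- The negative one-sided topological Markov shift: `y i` is the symbol at position `-i`. -/
abbrev NegShift (Adj : S → S → Prop) : Type _ :=
  {y : ℕ → S // ∀ i, Adj (y (i + 1)) (y i)}

/-- The right shift `T⁻¹` on the negative one-sided shift. -/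
def negShiftMap (Adj : S → S → Prop) (y : NegShift Adj) : NegShift Adj :=
  ⟨fun i => y.1 (i + 1), fun i => y.2 (i + 1)⟩

/-- The two-sided topological Markov shift. -/
abbrev TwoShift (Adj : S → S → Prop) : Type _ :=
  {z : ℤ → S // ∀ i, Adj (z i) (z (i + 1))}

/-- The two-sided left shift. -/
def twoShiftMap (Adj : S → S → Prop) (z : TwoShift Adj) : TwoShift Adj :=
  ⟨fun i => z.1 (i + 1), fun i => by simpa [add_assoc] using z.2 (i + 1)⟩

/-- Projection `z ↦ z⁺`. -/
def projP (Adj : S → S → Prop) (z : TwoShift Adj) : MShift Adj :=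
  ⟨fun i => z.1 i, fun i => by exact_mod_cast z.2 i⟩

/-- Projection `z ↦ z⁻`. -/
def projM (Adj : S → S → Prop) (z : TwoShift Adj) : NegShift Adj :=
  ⟨fun i => z.1 (-(i : ℤ)), fun i => by
    have h := z.2 (-((i : ℤ) + 1))
    have : -((i : ℤ) + 1) + 1 = -(i : ℤ) := by ring
    rw [this] at h
    exact_mod_cast h⟩

/-- The Ruelle operator on the positive one-sided shift. -/
noncomputable def RuelleP (Adj : S → S → Prop) (φ : MShift Adj → ℝ)
    (f : MShift Adj → ℝ≥0∞) (x : MShift Adj) : ℝ≥0∞ :=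
  ∑' y : {y : MShift Adj // shiftMap Adj y = x}, ENNReal.ofReal (Real.exp (φ y.1)) * f y.1

/-- The (reversed) Ruelle operator on the negative one-sided shift. -/
noncomputable def RuelleM (Adj : S → S → Prop) (φ : NegShift Adj → ℝ)
    (f : NegShift Adj → ℝ≥0∞) (y : NegShift Adj) : ℝ≥0∞ :=
  ∑' y' : {y' : NegShift Adj // negShiftMap Adj y' = y},
    ENNReal.ofReal (Real.exp (φ y'.1)) * f y'.1

/-- Green's function on the positive shift. -/
noncomputable def GreenP (Adj : S → S → Prop) (φ : MShift Adj → ℝ) (lam : ℝ)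
    (f : MShift Adj → ℝ≥0∞) (x : MShift Adj) : ℝ≥0∞ :=
  ∑' n : ℕ, ENNReal.ofReal ((lam ^ n)⁻¹) * ((RuelleP Adj φ)^[n] f) x

/-- Green's function on the negative shift. -/
noncomputable def GreenM (Adj : S → S → Prop) (φ : NegShift Adj → ℝ) (lam : ℝ)
    (f : NegShift Adj → ℝ≥0∞) (y : NegShift Adj) : ℝ≥0∞ :=
  ∑' n : ℕ, ENNReal.ofReal ((lam ^ n)⁻¹) * ((RuelleM Adj φ)^[n] f) y

/-- Summable variations on the positive shift (expressed via a summable modulus). -/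
def SummableVarP (Adj : S → S → Prop) (φ : MShift Adj → ℝ) : Prop :=
  ∃ V : ℕ → ℝ, Summable V ∧
    ∀ (m : ℕ) (x y : MShift Adj), (∀ i < m, x.1 i = y.1 i) → |φ x - φ y| ≤ V m

/-- Summable variations on the negative shift (expressed via a summable modulus). -/
def SummableVarM (Adj : S → S → Prop) (φ : NegShift Adj → ℝ) : Prop :=
  ∃ V : ℕ → ℝ, Summable V ∧
    ∀ (m : ℕ) (x y : NegShift Adj), (∀ i < m, x.1 i = y.1 i) → |φ x - φ y| ≤ V m

/-- Transitivity. -/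
def TransitiveShift (Adj : S → S → Prop) : Prop :=
  ∀ a b : S, ∃ (n : ℕ) (x : MShift Adj), x.1 0 = a ∧ ((shiftMap Adj)^[n] x).1 0 = b

/-- Uniform continuity of the transfer function `ψ` on the two-sided shift. -/
def UnifContTwoSided (Adj : S → S → Prop) (ψ : TwoShift Adj → ℝ) : Prop :=
  ∀ ε > (0 : ℝ), ∃ N : ℕ, ∀ z w : TwoShift Adj,
    (∀ i : ℤ, |i| ≤ (N : ℤ) → z.1 i = w.1 i) → |ψ z - ψ w| < ε

section TransferOperator

variable {α : Type*} (T : α → α) (φ : α → ℝ)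

/-- The transfer operator of a self-map `T` with potential `φ`. -/
noncomputable def transferOp (f : α → ℝ≥0∞) (x : α) : ℝ≥0∞ :=
  ∑' y : {y : α // T y = x}, ENNReal.ofReal (Real.exp (φ y.1)) * f y.1

/-- The preimages under `T^[n + 1]` are the `T^[n]`-preimages of the preimages under `T`. -/
def sigmaPreimageEquiv (n : ℕ) (x : α) :
    (Σ y : {y : α // T y = x}, {u : α // T^[n] u = y.1}) ≃ {u : α // T^[n + 1] u = x} where
  toFun p := ⟨p.2.1, by rw [Function.iterate_succ_apply', p.2.2, p.1.2]⟩
  invFun u := ⟨⟨T^[n] u.1, by rw [← Function.iterate_succ_apply' T, u.2]⟩, ⟨u.1, rfl⟩⟩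
  left_inv := by
    rintro ⟨⟨y, hy⟩, ⟨u, hu⟩⟩
    dsimp only at hu
    subst hu
    rfl
  right_inv _ := rfl

theorem transferOp_iterate (f : α → ℝ≥0∞) (n : ℕ) (x : α) :
    (transferOp T φ)^[n] f x =
      ∑' u : {u : α // T^[n] u = x},
        ENNReal.ofReal (Real.exp (birkhoffSum T φ n u.1)) * f u.1 := by
  induction n generalizing x with
  | zero =>
    simp only [Function.iterate_zero, id_eq, birkhoffSum_zero', Pi.zero_apply, Real.exp_zero,
      ENNReal.ofReal_one, one_mul]
    rw [tsum_eq_single (⟨x, rfl⟩ : {u : α // u = x})]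
    rintro ⟨u, rfl⟩ h
    exact absurd rfl h
  | succ n ih =>
    rw [Function.iterate_succ_apply', transferOp, ← (sigmaPreimageEquiv T n x).tsum_eq,
      ENNReal.tsum_sigma']
    refine tsum_congr fun y => ?_
    rw [ih, ← ENNReal.tsum_mul_left]
    refine tsum_congr fun u => ?_
    change _ = ENNReal.ofReal (Real.exp (birkhoffSum T φ (n + 1) u.1)) * f u.1
    rw [birkhoffSum_succ, u.2, Real.exp_add, ENNReal.ofReal_mul (Real.exp_pos _).le]
    ring

/-- If `g` parametrizes the points of `A` that `T^[n]` sends to `x`, then the iterated transfer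
operator applied to the indicator of `A` is a sum over the parameter space. -/
theorem transferOp_iterate_indicator_eq_tsum {ι : Type*} (g : ι → α) (hg : Function.Injective g)
    (A : Set α) (n : ℕ) (x : α) (hrange : ∀ u, u ∈ Set.range g ↔ T^[n] u = x ∧ u ∈ A) :
    (transferOp T φ)^[n] (A.indicator 1) x =
      ∑' i, ENNReal.ofReal (Real.exp (birkhoffSum T φ n (g i))) := by
  have hmem (i : ι) : T^[n] (g i) = x ∧ g i ∈ A := (hrange _).1 ⟨i, rfl⟩
  let G : ι → {u : α // T^[n] u = x} := fun i => ⟨g i, (hmem i).1⟩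
  have hG : Function.Injective G := fun i j h => hg (congrArg Subtype.val h)
  rw [transferOp_iterate, ← hG.tsum_eq]
  · refine tsum_congr fun i => ?_
    simp [G, (hmem i).2]
  · rintro ⟨u, hu⟩ hsupp
    have huA : u ∈ A := by
      by_contra h
      simp [h] at hsupp
    obtain ⟨i, hi⟩ := (hrange u).2 ⟨hu, huA⟩
    exact ⟨i, Subtype.ext hi⟩

end TransferOperator

section TwoSided

variable {Adj : S → S → Prop}

theorem projP_twoShiftMap (z : TwoShift Adj) :
    projP Adj (twoShiftMap Adj z) = shiftMap Adj (projP Adj z) := by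
  ext i
  simp [projP, twoShiftMap, shiftMap]

theorem negShiftMap_projM_twoShiftMap (z : TwoShift Adj) :
    negShiftMap Adj (projM Adj (twoShiftMap Adj z)) = projM Adj z := by
  ext i
  simp [projM, twoShiftMap, negShiftMap]

theorem projP_iterate (n : ℕ) (z : TwoShift Adj) :
    projP Adj ((twoShiftMap Adj)^[n] z) = (shiftMap Adj)^[n] (projP Adj z) :=
  Function.Semiconj.iterate_right (f := projP Adj) projP_twoShiftMap n z

theorem negShiftMap_iterate_projM (n : ℕ) (z : TwoShift Adj) :
    (negShiftMap Adj)^[n] (projM Adj ((twoShiftMap Adj)^[n] z)) = projM Adj z := by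
  induction n with
  | zero => rfl
  | succ n ih =>
    rw [Function.iterate_succ_apply, Function.iterate_succ_apply' (twoShiftMap Adj),
      negShiftMap_projM_twoShiftMap, ih]

theorem projM_zero (z : TwoShift Adj) : (projM Adj z).1 0 = z.1 0 := by simp [projM]

theorem projP_zero (z : TwoShift Adj) : (projP Adj z).1 0 = z.1 0 := by simp [projP]

theorem twoShiftMap_bijective : Function.Bijective (twoShiftMap Adj) := by
  constructor
  · intro z w h
    ext i
    simpa [twoShiftMap] using congrFun (congrArg Subtype.val h) (i - 1)
  · intro z
    refine ⟨⟨fun i => z.1 (i - 1), fun i => ?_⟩, ?_⟩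
    · have := z.2 (i - 1)
      rwa [show i - 1 + 1 = i + 1 - 1 by ring] at this
    · ext i
      simp [twoShiftMap]

theorem twoShift_ext {z w : TwoShift Adj} (hM : projM Adj z = projM Adj w)
    (hP : projP Adj z = projP Adj w) : z = w := by
  ext i
  obtain ⟨n, rfl | rfl⟩ := i.eq_nat_or_neg
  · exact congrFun (congrArg Subtype.val hP) n
  · exact congrFun (congrArg Subtype.val hM) n

theorem exists_projM_projP_eq (y : NegShift Adj) (x : MShift Adj) (h : y.1 0 = x.1 0) :
    ∃ z : TwoShift Adj, projM Adj z = y ∧ projP Adj z = x := by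
  refine ⟨⟨fun i => if 0 ≤ i then x.1 i.toNat else y.1 (-i).toNat, fun i => ?_⟩, ?_, ?_⟩
  · obtain ⟨n, rfl | rfl⟩ := i.eq_nat_or_neg
    · have : (0 : ℤ) ≤ n + 1 := by positivity
      simpa [this] using x.2 n
    · cases n with
      | zero => simpa using x.2 0
      | succ n =>
        have hneg : ¬ (0 : ℤ) ≤ -((n + 1 : ℕ) : ℤ) := by omega
        have hsucc : -((n + 1 : ℕ) : ℤ) + 1 = -(n : ℤ) := by push_cast; ring
        beta_reduce
        rw [if_neg hneg, hsucc]
        cases n with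
        | zero => simpa [← h] using y.2 0
        | succ n =>
          have hneg' : ¬ (0 : ℤ) ≤ -((n + 1 : ℕ) : ℤ) := by omega
          rw [if_neg hneg', neg_neg, neg_neg, Int.toNat_natCast, Int.toNat_natCast]
          exact y.2 (n + 1)
  · ext n
    cases n with
    | zero => simp [projM, h]
    | succ n =>
      have hneg : ¬ (0 : ℤ) ≤ -((n + 1 : ℕ) : ℤ) := by omega
      simp only [projM]
      rw [if_neg hneg, neg_neg, Int.toNat_natCast]
  · ext n
    simp [projP]

/-- Bi-infinite paths which pass through `y` up to time `0` and through `x` from time `n` on. -/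
abbrev BridgeSpace (y : NegShift Adj) (x : MShift Adj) (n : ℕ) : Type _ :=
  {z : TwoShift Adj // projM Adj z = y ∧ projP Adj ((twoShiftMap Adj)^[n] z) = x}

theorem iterate_RuelleP_indicator (φ : MShift Adj → ℝ) (y : NegShift Adj) (x : MShift Adj)
    (n : ℕ) :
    (RuelleP Adj φ)^[n] (Set.indicator {x' : MShift Adj | x'.1 0 = y.1 0} 1) x =
      ∑' z : BridgeSpace y x n,
        ENNReal.ofReal (Real.exp (birkhoffSum (shiftMap Adj) φ n (projP Adj z.1))) := by
  refine transferOp_iterate_indicator_eq_tsum (shiftMap Adj) φ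
    (fun z : BridgeSpace y x n => projP Adj z.1) ?_ _ n x fun u => ⟨?_, ?_⟩
  · exact fun z w h => Subtype.ext (twoShift_ext (z.2.1.trans w.2.1.symm) h)
  · rintro ⟨z, rfl⟩
    refine ⟨(projP_iterate n z.1).symm.trans z.2.2, ?_⟩
    rw [Set.mem_ofPred_eq, projP_zero, ← projM_zero, z.2.1]
  · rintro ⟨hu, hu0⟩
    obtain ⟨z, hzM, hzP⟩ := exists_projM_projP_eq y u hu0.symm
    exact ⟨⟨z, hzM, by rw [projP_iterate, hzP, hu]⟩, hzP⟩

theorem iterate_RuelleM_indicator (φ : NegShift Adj → ℝ) (y : NegShift Adj) (x : MShift Adj)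
    (n : ℕ) :
    (RuelleM Adj φ)^[n] (Set.indicator {y' : NegShift Adj | y'.1 0 = x.1 0} 1) y =
      ∑' z : BridgeSpace y x n, ENNReal.ofReal (Real.exp
        (birkhoffSum (negShiftMap Adj) φ n (projM Adj ((twoShiftMap Adj)^[n] z.1)))) := by
  have hbij := twoShiftMap_bijective (Adj := Adj) |>.iterate n
  refine transferOp_iterate_indicator_eq_tsum (negShiftMap Adj) φ
    (fun z : BridgeSpace y x n => projM Adj ((twoShiftMap Adj)^[n] z.1)) ?_ _ n y
    fun u => ⟨?_, ?_⟩
  · exact fun z w h => Subtype.ext (hbij.1 (twoShift_ext h (z.2.2.trans w.2.2.symm)))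
  · rintro ⟨z, rfl⟩
    refine ⟨(negShiftMap_iterate_projM n z.1).trans z.2.1, ?_⟩
    rw [Set.mem_ofPred_eq, projM_zero, ← projP_zero, z.2.2]
  · rintro ⟨hu, hu0⟩
    obtain ⟨w, hwM, hwP⟩ := exists_projM_projP_eq u x hu0
    obtain ⟨z, rfl⟩ := hbij.2 w
    exact ⟨⟨z, by rw [← negShiftMap_iterate_projM n z, hwM, hu], hwP⟩, hwM⟩

theorem birkhoffSum_sub_birkhoffSum {φp : MShift Adj → ℝ} {φm : NegShift Adj → ℝ}
    {ψ : TwoShift Adj → ℝ}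
    (hcoh : ∀ z : TwoShift Adj,
      φp (projP Adj z) - φm (projM Adj z) = ψ z - ψ (twoShiftMap Adj z))
    (n : ℕ) (z : TwoShift Adj) :
    birkhoffSum (shiftMap Adj) φp n (projP Adj z) -
        birkhoffSum (negShiftMap Adj) φm n (projM Adj ((twoShiftMap Adj)^[n] z)) =
      ψ z - ψ ((twoShiftMap Adj)^[n] z) +
        (φm (projM Adj z) - φm (projM Adj ((twoShiftMap Adj)^[n] z))) := by
  induction n with
  | zero => simp
  | succ n ih =>
    rw [birkhoffSum_succ, birkhoffSum_succ', Function.iterate_succ_apply' (twoShiftMap Adj),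
      negShiftMap_projM_twoShiftMap, ← projP_iterate]
    linarith [hcoh ((twoShiftMap Adj)^[n] z)]

theorem finite_symbols_of_zero_eq (hlocF : ∀ a : S, {b : S | Adj a b}.Finite)
    (hlocB : ∀ b : S, {a : S | Adj a b}.Finite) (a : S) (i : ℤ) :
    ((fun z : TwoShift Adj => z.1 i) '' {z | z.1 0 = a}).Finite := by
  induction i with
  | zero =>
    refine (Set.finite_singleton a).subset ?_
    rintro _ ⟨z, hz, rfl⟩
    exact hz
  | succ i ih =>
    refine (ih.biUnion fun b _ => hlocF b).subset ?_
    rintro _ ⟨z, hz, rfl⟩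
    exact Set.mem_biUnion ⟨z, hz, rfl⟩ (z.2 i)
  | pred i ih =>
    refine (ih.biUnion fun b _ => hlocB b).subset ?_
    rintro _ ⟨z, hz, rfl⟩
    refine Set.mem_biUnion ⟨z, hz, rfl⟩ ?_
    simpa using z.2 (-(i : ℤ) - 1)

/-- A uniformly continuous function on a locally compact two-sided shift is bounded on each
cylinder of length one. -/
theorem UnifContTwoSided.exists_bound {ψ : TwoShift Adj → ℝ} (hψ : UnifContTwoSided Adj ψ)
    (hlocF : ∀ a : S, {b : S | Adj a b}.Finite) (hlocB : ∀ b : S, {a : S | Adj a b}.Finite)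
    (a : S) : ∃ C : ℝ, ∀ z : TwoShift Adj, z.1 0 = a → |ψ z| ≤ C := by
  obtain ⟨N, hN⟩ := hψ 1 one_pos
  let r : TwoShift Adj → (Set.Icc (-(N : ℤ)) N → S) := fun z i => z.1 i
  have hfin : (r '' {z | z.1 0 = a}).Finite := by
    refine (Set.Finite.pi' fun i : Set.Icc (-(N : ℤ)) N =>
      finite_symbols_of_zero_eq hlocF hlocB a i.1).subset ?_
    rintro _ ⟨z, hz, rfl⟩ i
    exact ⟨z, hz, rfl⟩
  obtain ⟨t, -, ht⟩ := Set.exists_subset_bijOn {z | z.1 0 = a} r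
  have htfin : t.Finite := ht.finite_iff_finite.2 hfin
  obtain ⟨C, hC⟩ := (htfin.image fun z => |ψ z|).bddAbove
  refine ⟨C + 1, fun z hz => ?_⟩
  obtain ⟨w, hw, hwz⟩ : r z ∈ r '' t := by
    rw [ht.image_eq]
    exact ⟨z, hz, rfl⟩
  have h1 : |ψ z - ψ w| < 1 :=
    hN z w fun i hi => (congrFun hwz ⟨i, abs_le.1 hi⟩).symm
  have h2 : |ψ w| ≤ C := hC ⟨w, hw, rfl⟩
  linarith [abs_sub_abs_le_abs_sub (ψ z) (ψ w)]

theorem TransitiveShift.exists_pred (h : TransitiveShift Adj) (a : S) : ∃ b, Adj b a := by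
  obtain ⟨_, x, rfl, -⟩ := h a a
  obtain ⟨n, w, hw0, hwn⟩ := h (x.1 1) (x.1 0)
  cases n with
  | zero => exact ⟨x.1 0, by simpa [← hw0, ← hwn] using x.2 0⟩
  | succ n =>
    refine ⟨((shiftMap Adj)^[n] w).1 0, ?_⟩
    rw [Function.iterate_succ_apply'] at hwn
    rw [← hwn]
    exact ((shiftMap Adj)^[n] w).2 0

theorem TransitiveShift.exists_negShift (h : TransitiveShift Adj) (a : S) :
    ∃ y : NegShift Adj, y.1 0 = a := by
  choose p hp using h.exists_pred
  refine ⟨⟨fun i => p^[i] a, fun i => ?_⟩, rfl⟩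
  beta_reduce
  rw [Function.iterate_succ_apply']
  exact hp _

/-- The Green functions of cohomologous potentials have the same finiteness at each pair of
points. -/
theorem GreenP_ne_top_iff_GreenM_ne_top (hlocF : ∀ a : S, {b : S | Adj a b}.Finite)
    (hlocB : ∀ b : S, {a : S | Adj a b}.Finite)
    {φp : MShift Adj → ℝ} {φm : NegShift Adj → ℝ} (hvm : SummableVarM Adj φm)
    {ψ : TwoShift Adj → ℝ} (hψ : UnifContTwoSided Adj ψ)
    (hcoh : ∀ z : TwoShift Adj,
      φp (projP Adj z) - φm (projM Adj z) = ψ z - ψ (twoShiftMap Adj z))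
    (lam : ℝ) (y : NegShift Adj) (x : MShift Adj) :
    GreenP Adj φp lam (Set.indicator {x' : MShift Adj | x'.1 0 = y.1 0} 1) x ≠ ⊤ ↔
      GreenM Adj φm lam (Set.indicator {y' : NegShift Adj | y'.1 0 = x.1 0} 1) y ≠ ⊤ := by
  obtain ⟨V, -, hV⟩ := hvm
  obtain ⟨Ca, hCa⟩ := hψ.exists_bound hlocF hlocB (y.1 0)
  obtain ⟨Cb, hCb⟩ := hψ.exists_bound hlocF hlocB (x.1 0)
  have hbound (n : ℕ) (z : BridgeSpace y x n) :
      |birkhoffSum (shiftMap Adj) φp n (projP Adj z.1) -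
        birkhoffSum (negShiftMap Adj) φm n (projM Adj ((twoShiftMap Adj)^[n] z.1))| ≤
        Ca + Cb + V 0 := by
    have h1 := abs_le.1 (hCa z.1 (by rw [← projM_zero, z.2.1]))
    have h2 := abs_le.1 (hCb ((twoShiftMap Adj)^[n] z.1) (by rw [← projP_zero, z.2.2]))
    have h3 := abs_le.1 (hV 0 (projM Adj z.1) (projM Adj ((twoShiftMap Adj)^[n] z.1)) (by simp))
    rw [birkhoffSum_sub_birkhoffSum hcoh, abs_le]
    constructor <;> linarith [h1.1, h1.2, h2.1, h2.2, h3.1, h3.2]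
  have hcompare {f g : (n : ℕ) → BridgeSpace y x n → ℝ}
      (hfg : ∀ n z, |f n z - g n z| ≤ Ca + Cb + V 0)
      (hg : ∑' n : ℕ, ENNReal.ofReal ((lam ^ n)⁻¹) *
        ∑' z, ENNReal.ofReal (Real.exp (g n z)) ≠ ⊤) :
      ∑' n : ℕ, ENNReal.ofReal ((lam ^ n)⁻¹) * ∑' z, ENNReal.ofReal (Real.exp (f n z)) ≠ ⊤ := by
    refine ne_top_of_le_ne_top
      (ENNReal.mul_ne_top (ENNReal.ofReal_ne_top (r := Real.exp (Ca + Cb + V 0))) hg) ?_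
    rw [← ENNReal.tsum_mul_left]
    refine ENNReal.tsum_le_tsum fun n => ?_
    rw [mul_left_comm]
    gcongr
    rw [← ENNReal.tsum_mul_left]
    refine ENNReal.tsum_le_tsum fun z => ?_
    rw [← ENNReal.ofReal_mul (Real.exp_pos _).le, ← Real.exp_add]
    gcongr
    linarith [(abs_le.1 (hfg n z)).2]
  simp only [GreenP, GreenM, iterate_RuelleP_indicator, iterate_RuelleM_indicator]
  exact ⟨hcompare fun n z => by rw [abs_sub_comm]; exact hbound n z, hcompare hbound⟩

end TwoSided

/-- If `φ⁺` and `φ⁻` have summable variations and are cohomologous via a uniformly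
continuous transfer function `ψ`, then `φ⁺` is `λ`-transient iff `φ⁻` is
`λ`-transient. -/
theorem transience_transfer [Countable S]
    (Adj : S → S → Prop) (htrans : TransitiveShift Adj)
    (hlocF : ∀ a : S, {b : S | Adj a b}.Finite)
    (hlocB : ∀ b : S, {a : S | Adj a b}.Finite)
    (φp : MShift Adj → ℝ) (hvp : SummableVarP Adj φp)
    (φm : NegShift Adj → ℝ) (hvm : SummableVarM Adj φm)
    (ψ : TwoShift Adj → ℝ) (hψ : UnifContTwoSided Adj ψ)
    (hcoh : ∀ z : TwoShift Adj,
      φp (projP Adj z) - φm (projM Adj z) = ψ z - ψ (twoShiftMap Adj z))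
    (lam : ℝ) (hlam : 0 < lam) :
    (∀ (a : S) (x : MShift Adj),
        GreenP Adj φp lam (Set.indicator {x' : MShift Adj | x'.1 0 = a} 1) x ≠ ⊤) ↔
    (∀ (a : S) (y : NegShift Adj),
        GreenM Adj φm lam (Set.indicator {y' : NegShift Adj | y'.1 0 = a} 1) y ≠ ⊤) := by
  have key := GreenP_ne_top_iff_GreenM_ne_top hlocF hlocB hvm hψ hcoh lam
  constructor
  · intro h a y
    obtain ⟨_, x, rfl, -⟩ := htrans a a
    exact (key y x).1 (h _ x)
  · intro h a x
    obtain ⟨y, rfl⟩ := htrans.exists_negShift a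
    exact (key y x).2 (h _ y)
end

section
/- Let (X⁺, T) be a transitive locally compact one-sided countable Markov shift and φ a λ-transient potential with summable variations. For each boundary point ω of the Martin compactification, the limit μ_ω(f) := lim_{x→ω (in ρ)} K(f, x | λ) exists for all f ∈ C_c(X⁺), defines a positive Radon measure on X⁺, and this measure is λ-conformal: μ_ω(L_φ f) = λ μ_ω(f) for every f ∈ C_c(X⁺). In particular, since the Martin boundary is non-empty, there exists a non-zero positive Radon measure μ with L_φ* μ = λμ. -/
open MeasureTheory ENNReal Filter Topology

variable {S : Type*}

/-- The Ruelle (transfer) operator on non-negative functions. -/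
noncomputable def Ruelle (Adj : S → S → Prop) (φ : MShift Adj → ℝ)
    (f : MShift Adj → ℝ≥0∞) (x : MShift Adj) : ℝ≥0∞ :=
  ∑' y : {y : MShift Adj // shiftMap Adj y = x}, ENNReal.ofReal (Real.exp (φ y.1)) * f y.1

/-- The Green's function `G(f, x | λ) = Σ_n λ⁻ⁿ (L_φⁿ f)(x)`. -/
noncomputable def Green (Adj : S → S → Prop) (φ : MShift Adj → ℝ) (lam : ℝ)
    (f : MShift Adj → ℝ≥0∞) (x : MShift Adj) : ℝ≥0∞ :=
  ∑' n : ℕ, ENNReal.ofReal ((lam ^ n)⁻¹) * ((Ruelle Adj φ)^[n] f) x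

/-- The cylinder set `[a] = {x : x₀ = a}`. -/
def cylA (Adj : S → S → Prop) (a : S) : Set (MShift Adj) := {x | x.1 0 = a}

/-- Indicator function of the cylinder `[a]`. -/
noncomputable def cylInd (Adj : S → S → Prop) (a : S) : MShift Adj → ℝ≥0∞ :=
  (cylA Adj a).indicator 1

/-- Local compactness: each state has finitely many followers. -/
def LocFin (Adj : S → S → Prop) : Prop := ∀ a : S, {b : S | Adj a b}.Finite

/-- Set of values `|φ(x) − φ(y)|` over pairs agreeing in their first `m` coordinates. -/
def varSet (Adj : S → S → Prop) (φ : MShift Adj → ℝ) (m : ℕ) : Set ℝ :=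
  {r | ∃ x y : MShift Adj, (∀ i < m, x.1 i = y.1 i) ∧ r = |φ x - φ y|}

/-- The `m`-th variation of `φ`. -/
noncomputable def Var (Adj : S → S → Prop) (φ : MShift Adj → ℝ) (m : ℕ) : ℝ :=
  sSup (varSet Adj φ m)

/-- `φ` has summable variations. -/
def SummableVar (Adj : S → S → Prop) (φ : MShift Adj → ℝ) : Prop :=
  (∀ m, BddAbove (varSet Adj φ m)) ∧ Summable (Var Adj φ)

/-- A non-negative real function viewed as `ℝ≥0∞`-valued. -/
noncomputable def ofR {Adj : S → S → Prop} (f : MShift Adj → ℝ) : MShift Adj → ℝ≥0∞ :=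
  fun x => ENNReal.ofReal (f x)

/-- `λ`-transience: the Green's function of every cylinder is finite everywhere. -/
def Transient (Adj : S → S → Prop) (φ : MShift Adj → ℝ) (lam : ℝ) : Prop :=
  ∀ (a : S) (x : MShift Adj), Green Adj φ lam (cylInd Adj a) x ≠ ⊤

/-- The cylinder set of a (non-empty) word. -/
def cylSigma (Adj : S → S → Prop) (w : (m : ℕ) × (Fin (m + 1) → S)) :
    Set (MShift Adj) :=
  {x | ∀ i : Fin (w.1 + 1), x.1 i = w.2 i}

/-- Real-valued Martin kernel of a set `B`, with origin cylinder `[o]`. -/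
noncomputable def MartinKr (Adj : S → S → Prop) (φ : MShift Adj → ℝ) (lam : ℝ) (o : S)
    (B : Set (MShift Adj)) (x : MShift Adj) : ℝ :=
  (Green Adj φ lam (B.indicator 1) x / Green Adj φ lam (cylInd Adj o) x).toReal

/-- The Martin (pseudo-)metric associated to an enumeration `e` of words and bounds `C`. -/
noncomputable def martinRho (Adj : S → S → Prop) (φ : MShift Adj → ℝ) (lam : ℝ) (o : S)
    (e : ℕ → (m : ℕ) × (Fin (m + 1) → S)) (C : ℕ → ℝ) (x y : MShift Adj) : ℝ :=
  ∑' i : ℕ, ((2 : ℝ) ^ i * (C i + 1))⁻¹ *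
    (|MartinKr Adj φ lam o (cylSigma Adj (e i)) x -
        MartinKr Adj φ lam o (cylSigma Adj (e i)) y| +
      |Set.indicator (cylSigma Adj (e i)) (fun _ => (1 : ℝ)) x -
        Set.indicator (cylSigma Adj (e i)) (fun _ => (1 : ℝ)) y|)


/-- A sequence is Cauchy for the Martin metric. -/
def RhoCauchy (Adj : S → S → Prop) (φ : MShift Adj → ℝ) (lam : ℝ) (o : S)
    (e : ℕ → (m : ℕ) × (Fin (m + 1) → S)) (C : ℕ → ℝ) (u : ℕ → MShift Adj) : Prop :=
  ∀ ε > (0 : ℝ), ∃ N : ℕ, ∀ m ≥ N, ∀ n ≥ N,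
    martinRho Adj φ lam o e C (u m) (u n) < ε

/-- A sequence `ρ`-converges to a point of `X⁺`. -/
def RhoTendsto (Adj : S → S → Prop) (φ : MShift Adj → ℝ) (lam : ℝ) (o : S)
    (e : ℕ → (m : ℕ) × (Fin (m + 1) → S)) (C : ℕ → ℝ) (u : ℕ → MShift Adj)
    (x : MShift Adj) : Prop :=
  Filter.Tendsto (fun n => martinRho Adj φ lam o e C (u n) x) Filter.atTop (nhds 0)


/-- A non-negative real function viewed as `ℝ≥0∞`-valued (for use in the Green's
function). -/
noncomputable def ofRG {Adj : S → S → Prop} (f : MShift Adj → ℝ) : MShift Adj → ℝ≥0∞ :=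
  fun x => ENNReal.ofReal (f x)

/-- The real-valued Ruelle operator (the sum has finitely many non-zero terms for
compactly supported `f`). -/
noncomputable def RuelleR (Adj : S → S → Prop) (φ : MShift Adj → ℝ)
    (f : MShift Adj → ℝ) (x : MShift Adj) : ℝ :=
  ∑' y : {y : MShift Adj // shiftMap Adj y = x}, Real.exp (φ y.1) * f y.1

namespace MShift

variable {Adj : S → S → Prop}

/-- The point `a x₀ x₁ …` obtained by prepending an admissible letter to `x`. -/
def cons (a : S) (x : MShift Adj) (h : Adj a (x.1 0)) : MShift Adj :=
  ⟨fun i => Nat.casesOn i a x.1, fun i => by cases i with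
    | zero => exact h
    | succ i => exact x.2 i⟩

lemma shiftMap_cons (a : S) (x : MShift Adj) (h : Adj a (x.1 0)) :
    shiftMap Adj (cons a x h) = x := rfl

lemma cons_shiftMap (y : MShift Adj) : cons (y.1 0) (shiftMap Adj y) (y.2 0) = y := by
  apply Subtype.ext
  funext i
  cases i <;> rfl

open Classical in
/-- Sums over the preimages of a point under the shift, indexed by the prepended letter. -/
lemma tsum_preimage {M : Type*} [AddCommMonoid M] [TopologicalSpace M] [T2Space M]
    (F : MShift Adj → M) (x : MShift Adj) :
    ∑' y : {y : MShift Adj // shiftMap Adj y = x}, F y.1 =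
      ∑' a : S, if h : Adj a (x.1 0) then F (cons a x h) else 0 := by
  have hinj : Function.Injective
      (fun y : {y : MShift Adj // shiftMap Adj y = x} => y.1.1 0) := by
    rintro ⟨y, rfl⟩ ⟨z, hz⟩ h
    apply Subtype.ext
    apply Subtype.ext
    funext i
    cases i with
    | zero => exact h
    | succ i => exact (congrFun (congrArg Subtype.val hz) i).symm
  rw [← hinj.tsum_eq]
  · refine tsum_congr ?_
    rintro ⟨y, rfl⟩
    have h : Adj (y.1 0) ((shiftMap Adj y).1 0) := y.2 0
    simp only [dif_pos h, cons_shiftMap]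
  · intro a ha
    by_cases h : Adj a (x.1 0)
    · exact ⟨⟨cons a x h, shiftMap_cons a x h⟩, rfl⟩
    · simp [h] at ha

end MShift

open MShift

section Operator

variable {Adj : S → S → Prop} {φ : MShift Adj → ℝ} {lam : ℝ}

open Classical in
lemma ruelle_eq_tsum (f : MShift Adj → ℝ≥0∞) (x : MShift Adj) :
    Ruelle Adj φ f x = ∑' a : S, if h : Adj a (x.1 0) then
      ENNReal.ofReal (Real.exp (φ (cons a x h))) * f (cons a x h) else 0 :=
  tsum_preimage (fun y => ENNReal.ofReal (Real.exp (φ y)) * f y) x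

open Classical in
lemma ruelleR_eq_tsum (f : MShift Adj → ℝ) (x : MShift Adj) :
    RuelleR Adj φ f x = ∑' a : S, if h : Adj a (x.1 0) then
      Real.exp (φ (cons a x h)) * f (cons a x h) else 0 :=
  tsum_preimage (fun y => Real.exp (φ y) * f y) x

lemma ruelleR_nonneg {f : MShift Adj → ℝ} (hf0 : 0 ≤ f) : 0 ≤ RuelleR Adj φ f :=
  fun _ => tsum_nonneg fun y => mul_nonneg (Real.exp_pos _).le (hf0 y.1)

lemma ruelle_mono {f g : MShift Adj → ℝ≥0∞} (h : f ≤ g) : Ruelle Adj φ f ≤ Ruelle Adj φ g :=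
  fun _ => ENNReal.tsum_le_tsum fun y => mul_le_mul_right (h y.1) _

lemma green_mono {f g : MShift Adj → ℝ≥0∞} (h : f ≤ g) : Green Adj φ lam f ≤ Green Adj φ lam g :=
  fun x => ENNReal.tsum_le_tsum fun n =>
    mul_le_mul_right ((show Monotone (Ruelle Adj φ) from fun _ _ => ruelle_mono).iterate n h x) _

/-- The resolvent identity `G(L f) = λ (G f - f)`. -/
lemma green_eq_add (hlam : 0 < lam) (f : MShift Adj → ℝ≥0∞) (x : MShift Adj) :
    Green Adj φ lam f x =
      f x + ENNReal.ofReal lam⁻¹ * Green Adj φ lam (Ruelle Adj φ f) x := by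
  unfold Green
  rw [tsum_eq_zero_add' ENNReal.summable, ← ENNReal.tsum_mul_left]
  congr 1
  · simp
  · refine tsum_congr fun n => ?_
    rw [← mul_assoc, ← ENNReal.ofReal_mul (by positivity), Function.iterate_succ_apply]
    congr 2
    rw [pow_succ']
    field_simp

lemma iterate_ruelle_cylInd_pos (z : MShift Adj) (n : ℕ) (x : MShift Adj)
    (hx : ((shiftMap Adj)^[n] z).1 0 = x.1 0) :
    0 < ((Ruelle Adj φ)^[n] (cylInd Adj (z.1 0))) x := by
  induction n generalizing x with
  | zero =>
    have : x ∈ cylA Adj (z.1 0) := hx.symm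
    simp [cylInd, this]
  | succ n ih =>
    rw [Function.iterate_succ_apply'] at hx ⊢
    have hadj : Adj (((shiftMap Adj)^[n] z).1 0) (x.1 0) :=
      hx ▸ ((shiftMap Adj)^[n] z).2 0
    refine lt_of_lt_of_le ?_ (ENNReal.le_tsum ⟨cons _ x hadj, shiftMap_cons _ x hadj⟩)
    exact ENNReal.mul_pos (by simp [Real.exp_pos]) (ih (cons _ x hadj) rfl).ne'

lemma green_cylInd_ne_zero (htrans : TransitiveShift Adj) (hlam : 0 < lam) (o : S)
    (x : MShift Adj) : Green Adj φ lam (cylInd Adj o) x ≠ 0 := by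
  obtain ⟨n, z, rfl, hz⟩ := htrans o (x.1 0)
  have hterm : 0 < ENNReal.ofReal ((lam ^ n)⁻¹) *
      ((Ruelle Adj φ)^[n] (cylInd Adj (z.1 0))) x :=
    ENNReal.mul_pos (by simp; positivity) (iterate_ruelle_cylInd_pos z n x hz).ne'
  exact ne_of_gt (hterm.trans_le (ENNReal.le_tsum n))

/-- The tail `∑_{j > k} Var_j φ`. -/
noncomputable def varTail (Adj : S → S → Prop) (φ : MShift Adj → ℝ) (k : ℕ) : ℝ :=
  ∑' j, Var Adj φ (j + (k + 1))

lemma var_nonneg (m : ℕ) : 0 ≤ Var Adj φ m := by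
  refine Real.sSup_nonneg ?_
  rintro _ ⟨x, y, -, rfl⟩
  exact abs_nonneg _

lemma abs_sub_le_var (hvar : SummableVar Adj φ) {m : ℕ} {x y : MShift Adj}
    (h : ∀ i < m, x.1 i = y.1 i) : |φ x - φ y| ≤ Var Adj φ m :=
  le_csSup (hvar.1 m) ⟨x, y, h, rfl⟩

lemma varTail_nonneg (k : ℕ) : 0 ≤ varTail Adj φ k := tsum_nonneg fun _ => var_nonneg _

lemma varTail_eq_add (hvar : SummableVar Adj φ) (k : ℕ) :
    varTail Adj φ k = Var Adj φ (k + 1) + varTail Adj φ (k + 1) := by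
  unfold varTail
  rw [((summable_nat_add_iff (k + 1)).2 hvar.2).tsum_eq_zero_add]
  congr 1
  · simp
  · exact tsum_congr fun j => by congr 1; ring

lemma tendsto_varTail : Tendsto (varTail Adj φ) atTop (𝓝 0) :=
  (tendsto_sum_nat_add (Var Adj φ)).comp (tendsto_add_atTop_nat 1)

/-- Bounded distortion for iterates of the Ruelle operator. -/
lemma iterate_ruelle_le (hvar : SummableVar Adj φ) {m : ℕ} {f : MShift Adj → ℝ≥0∞}
    (hf : ∀ x y : MShift Adj, (∀ i < m, x.1 i = y.1 i) → f x = f y) (n : ℕ) {k : ℕ}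
    (hk : m ≤ k) (hk0 : 0 < k) {x y : MShift Adj} (hxy : ∀ i < k, x.1 i = y.1 i) :
    ((Ruelle Adj φ)^[n] f) x ≤
      ENNReal.ofReal (Real.exp (varTail Adj φ k)) * ((Ruelle Adj φ)^[n] f) y := by
  induction n generalizing k x y with
  | zero =>
    simp only [Function.iterate_zero, id]
    rw [hf x y fun i hi => hxy i (hi.trans_le hk)]
    refine le_mul_of_one_le_left zero_le ?_
    rw [ENNReal.one_le_ofReal]
    exact Real.one_le_exp (varTail_nonneg k)
  | succ n ih =>
    simp only [Function.iterate_succ_apply']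
    rw [ruelle_eq_tsum, ruelle_eq_tsum, ← ENNReal.tsum_mul_left]
    refine ENNReal.tsum_le_tsum fun a => ?_
    by_cases h : Adj a (x.1 0)
    · have h' : Adj a (y.1 0) := hxy 0 hk0 ▸ h
      rw [dif_pos h, dif_pos h']
      have hagree : ∀ i < k + 1, (cons a x h).1 i = (cons a y h').1 i := by
        intro i hi
        cases i with
        | zero => rfl
        | succ i => exact hxy i (by omega)
      have hφ := (abs_le.1 (abs_sub_le_var hvar hagree)).2
      calc _ ≤ ENNReal.ofReal (Real.exp (Var Adj φ (k + 1)) * Real.exp (φ (cons a y h'))) *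
            (ENNReal.ofReal (Real.exp (varTail Adj φ (k + 1))) *
              ((Ruelle Adj φ)^[n] f) (cons a y h')) := by
            refine mul_le_mul' (ENNReal.ofReal_le_ofReal ?_) (ih (by omega) (by omega) hagree)
            rw [← Real.exp_add]
            exact Real.exp_le_exp.2 (by linarith)
        _ = _ := by
            rw [varTail_eq_add hvar k, Real.exp_add, ENNReal.ofReal_mul (by positivity),
              ENNReal.ofReal_mul (by positivity)]
            ring
    · rw [dif_neg h]
      exact zero_le

/-- Bounded distortion for the Green's function. -/
lemma green_le (hvar : SummableVar Adj φ) {m : ℕ} {f : MShift Adj → ℝ≥0∞}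
    (hf : ∀ x y : MShift Adj, (∀ i < m, x.1 i = y.1 i) → f x = f y) {k : ℕ}
    (hk : m ≤ k) (hk0 : 0 < k) {x y : MShift Adj} (hxy : ∀ i < k, x.1 i = y.1 i) :
    Green Adj φ lam f x ≤
      ENNReal.ofReal (Real.exp (varTail Adj φ k)) * Green Adj φ lam f y := by
  unfold Green
  rw [← ENNReal.tsum_mul_left]
  refine ENNReal.tsum_le_tsum fun n => ?_
  rw [mul_left_comm]
  exact mul_le_mul_right (iterate_ruelle_le hvar hf n hk hk0 hxy) _

/-- The Green's function of a locally constant function converges along sequences that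
stabilise to `x` coordinatewise. -/
lemma tendsto_green (hvar : SummableVar Adj φ) {m : ℕ} {f : MShift Adj → ℝ≥0∞}
    (hf : ∀ x y : MShift Adj, (∀ i < m, x.1 i = y.1 i) → f x = f y)
    (hfin : ∀ x, Green Adj φ lam f x ≠ ⊤) {u : ℕ → MShift Adj} {x : MShift Adj}
    (hu : ∀ k, ∀ᶠ n in atTop, ∀ i < k, (u n).1 i = x.1 i) :
    Tendsto (fun n => (Green Adj φ lam f (u n)).toReal) atTop
      (𝓝 (Green Adj φ lam f x).toReal) := by
  have key : ∀ (k : ℕ), m ≤ k → 0 < k → ∀ y z : MShift Adj, (∀ i < k, y.1 i = z.1 i) →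
      (Green Adj φ lam f y).toReal ≤
        Real.exp (varTail Adj φ k) * (Green Adj φ lam f z).toReal := by
    intro k hk hk0 y z hyz
    have := ENNReal.toReal_mono (ENNReal.mul_ne_top ENNReal.ofReal_ne_top (hfin z))
      (green_le (lam := lam) hvar hf hk hk0 hyz)
    rwa [ENNReal.toReal_mul, ENNReal.toReal_ofReal (Real.exp_pos _).le] at this
  have hlim : ∀ s : ℝ, Tendsto (fun k => Real.exp (s * varTail Adj φ k) *
      (Green Adj φ lam f x).toReal) atTop (𝓝 (Green Adj φ lam f x).toReal) := by
    intro s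
    have := ((Real.continuous_exp.tendsto _).comp
      ((tendsto_varTail (φ := φ)).const_mul s)).mul_const (Green Adj φ lam f x).toReal
    simpa using this
  refine tendsto_order.2 ⟨fun b hb => ?_, fun b hb => ?_⟩
  · obtain ⟨k, hk, hk1⟩ := (((tendsto_order.1 (hlim (-1))).1 b hb).and
      (eventually_ge_atTop (m + 1))).exists
    filter_upwards [hu k] with n hn
    refine hk.trans_le ?_
    rw [neg_one_mul, Real.exp_neg, inv_mul_le_iff₀ (Real.exp_pos _)]
    exact key k (by omega) (by omega) _ _ fun i hi => (hn i hi).symm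
  · obtain ⟨k, hk, hk1⟩ := (((tendsto_order.1 (hlim 1)).2 b hb).and
      (eventually_ge_atTop (m + 1))).exists
    filter_upwards [hu k] with n hn
    refine lt_of_le_of_lt ?_ hk
    rw [one_mul]
    exact key k (by omega) (by omega) _ _ hn

end Operator

section Topology

variable {Adj : S → S → Prop} {φ : MShift Adj → ℝ} [TopologicalSpace S]

lemma exists_cylinder_subset {x : MShift Adj} {U : Set (MShift Adj)} (hU : U ∈ 𝓝 x) :
    ∃ k, ∀ y : MShift Adj, (∀ i < k, y.1 i = x.1 i) → y ∈ U := by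
  rw [nhds_subtype_eq_comap, mem_comap] at hU
  obtain ⟨V, hV, hVU⟩ := hU
  rw [nhds_pi, Filter.mem_pi] at hV
  obtain ⟨I, hI, t, ht, hsub⟩ := hV
  obtain ⟨N, hN⟩ := hI.bddAbove
  refine ⟨N + 1, fun y hy => hVU (hsub fun i hi => ?_)⟩
  rw [hy i (Nat.lt_succ_of_le (hN hi))]
  exact mem_of_mem_nhds (ht i)

/-- The initial letters of the support of `f`. -/
def suppLetters (f : MShift Adj → ℝ) : Set S := (fun x : MShift Adj => x.1 0) '' tsupport f

lemma eq_zero_of_notMem_suppLetters {f : MShift Adj → ℝ} {x : MShift Adj}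
    (hx : x.1 0 ∉ suppLetters f) : f x = 0 :=
  image_eq_zero_of_notMem_tsupport fun h => hx ⟨x, h, rfl⟩

lemma continuous_cons (a : S) :
    Continuous fun x : {x : MShift Adj // Adj a (x.1 0)} => cons a x.1 x.2 := by
  refine Continuous.subtype_mk (continuous_pi fun i => ?_) _
  cases i with
  | zero => exact continuous_const
  | succ i =>
    exact (continuous_apply i).comp (continuous_subtype_val.comp continuous_subtype_val)

variable [DiscreteTopology S]

lemma isClopen_setOf_zero (p : S → Prop) : IsClopen {x : MShift Adj | p (x.1 0)} :=
  (isClopen_discrete {a | p a}).preimage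
    ((continuous_apply 0).comp continuous_subtype_val)

lemma isOpen_cylinder (x : MShift Adj) (k : ℕ) :
    IsOpen {y : MShift Adj | ∀ i < k, y.1 i = x.1 i} := by
  have : {y : MShift Adj | ∀ i < k, y.1 i = x.1 i} =
      ⋂ i ∈ Set.Iio k, {y : MShift Adj | y.1 i = x.1 i} := by ext; simp
  rw [this]
  exact (Set.finite_Iio k).isOpen_biInter fun i _ =>
    (isOpen_discrete {a | a = x.1 i}).preimage
      (show Continuous fun y : MShift Adj => y.1 i from
        (continuous_apply i).comp continuous_subtype_val)

lemma isClosed_admissible (Adj : S → S → Prop) :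
    IsClosed {x : ℕ → S | ∀ i, Adj (x i) (x (i + 1))} := by
  rw [Set.ofPred_forall]
  refine isClosed_iInter fun i => ?_
  exact (isClosed_discrete {p : S × S | Adj p.1 p.2}).preimage
    (show Continuous fun x : ℕ → S => (x i, x (i + 1)) from
      (continuous_apply i).prodMk (continuous_apply (i + 1)))

lemma isCompact_setOf_zero_mem (hloc : LocFin Adj) {A : Set S} (hA : A.Finite) :
    IsCompact {x : MShift Adj | x.1 0 ∈ A} := by
  let F : ℕ → Set S := fun n => Nat.rec A (fun _ B => ⋃ a ∈ B, {b | Adj a b}) n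
  have hF : ∀ n, (F n).Finite := by
    intro n
    induction n with
    | zero => exact hA
    | succ n ih => exact ih.biUnion fun a _ => hloc a
  have hcpt : IsCompact (Subtype.val ⁻¹' Set.univ.pi F : Set (MShift Adj)) :=
    (isClosed_admissible Adj).isClosedEmbedding_subtypeVal.isCompact_preimage
      (isCompact_univ_pi fun n => (hF n).isCompact)
  refine hcpt.of_isClosed_subset (isClopen_setOf_zero (· ∈ A)).isClosed fun x hx n _ => ?_
  induction n with
  | zero => exact hx
  | succ n ih => exact Set.mem_biUnion (ih trivial) (x.2 n)

lemma locallyCompactSpace (hloc : LocFin Adj) : LocallyCompactSpace (MShift Adj) := by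
  have : WeaklyLocallyCompactSpace (MShift Adj) := ⟨fun x =>
    ⟨_, isCompact_setOf_zero_mem hloc (Set.finite_singleton (x.1 0)),
      (isClopen_setOf_zero (· ∈ ({x.1 0} : Set S))).isOpen.mem_nhds rfl⟩⟩
  infer_instance

lemma finite_image_zero {K : Set (MShift Adj)} (hK : IsCompact K) :
    ((fun x : MShift Adj => x.1 0) '' K).Finite :=
  (hK.image ((continuous_apply 0).comp continuous_subtype_val)).finite_of_discrete

lemma finite_suppLetters {f : MShift Adj → ℝ} (hf : HasCompactSupport f) :
    (suppLetters f).Finite := finite_image_zero hf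

lemma continuous_potential (hvar : SummableVar Adj φ) : Continuous φ := by
  rw [continuous_iff_continuousAt]
  intro x
  rw [ContinuousAt, Metric.tendsto_nhds]
  intro ε hε
  obtain ⟨k, hk⟩ := (hvar.2.tendsto_atTop_zero.eventually (gt_mem_nhds hε)).exists
  filter_upwards [(isOpen_cylinder x k).mem_nhds fun i _ => rfl] with y hy
  exact (abs_sub_le_var hvar hy).trans_lt hk

/-- A compactly supported continuous function is uniformly continuous with respect to the
partitions into cylinders. -/
lemma exists_uniform_cylinder {f : MShift Adj → ℝ} (hf : Continuous f)
    (hfc : HasCompactSupport f) (hloc : LocFin Adj) {ε : ℝ} (hε : 0 < ε) :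
    ∃ k, ∀ x y : MShift Adj, (∀ i < k + 1, x.1 i = y.1 i) → |f x - f y| < ε := by
  have hloc' : ∀ x : MShift Adj, ∃ k, ∀ y : MShift Adj, (∀ i < k, y.1 i = x.1 i) →
      |f y - f x| < ε / 2 := fun x =>
    exists_cylinder_subset (Metric.continuousAt_iff'.1 hf.continuousAt (ε / 2) (half_pos hε))
  choose k hk using hloc'
  obtain ⟨t, -, ht⟩ := (isCompact_setOf_zero_mem hloc (finite_suppLetters hfc)).elim_nhds_subcover
    (fun x => {y : MShift Adj | ∀ i < k x, y.1 i = x.1 i})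
    fun x _ => (isOpen_cylinder x (k x)).mem_nhds fun i _ => rfl
  refine ⟨t.sup k, fun x y hxy => ?_⟩
  by_cases hx : x.1 0 ∈ suppLetters f
  · obtain ⟨z, hz, hxz⟩ := Set.mem_iUnion₂.1 (ht hx)
    have h1 := hk z x hxz
    have h2 := hk z y fun i hi => by
      rw [← hxy i (hi.trans_le ((Finset.le_sup hz).trans (Nat.le_succ _)))]
      exact hxz i hi
    rw [abs_lt] at *
    constructor <;> linarith
  · rw [eq_zero_of_notMem_suppLetters hx,
      eq_zero_of_notMem_suppLetters (f := f) (x := y) (by rwa [← hxy 0 (Nat.succ_pos _)])]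
    simpa using hε

open Classical in
lemma ruelleR_eq_sum {f : MShift Adj → ℝ} (hf : HasCompactSupport f) (x : MShift Adj) :
    RuelleR Adj φ f x = ∑ a ∈ (finite_suppLetters hf).toFinset, if h : Adj a (x.1 0) then
      Real.exp (φ (cons a x h)) * f (cons a x h) else 0 := by
  rw [ruelleR_eq_tsum]
  refine tsum_eq_sum fun a ha => ?_
  split_ifs with h
  · rw [eq_zero_of_notMem_suppLetters (f := f), mul_zero]
    exact fun h' => ha ((Set.Finite.mem_toFinset _).2 h')
  · rfl

open Classical in
lemma ruelle_eq_sum {f : MShift Adj → ℝ} (hf : HasCompactSupport f) (x : MShift Adj) :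
    Ruelle Adj φ (ofRG f) x = ∑ a ∈ (finite_suppLetters hf).toFinset, if h : Adj a (x.1 0) then
      ENNReal.ofReal (Real.exp (φ (cons a x h))) * ENNReal.ofReal (f (cons a x h)) else 0 := by
  rw [ruelle_eq_tsum]
  refine tsum_eq_sum fun a ha => ?_
  split_ifs with h
  · rw [ofRG, eq_zero_of_notMem_suppLetters (f := f), ENNReal.ofReal_zero, mul_zero]
    exact fun h' => ha ((Set.Finite.mem_toFinset _).2 h')
  · rfl

lemma ruelle_ofRG {f : MShift Adj → ℝ} (hf : HasCompactSupport f) (hf0 : 0 ≤ f) :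
    Ruelle Adj φ (ofRG f) = ofRG (RuelleR Adj φ f) := by
  classical
  funext x
  rw [ruelle_eq_sum hf, ofRG, ruelleR_eq_sum hf, ENNReal.ofReal_sum_of_nonneg]
  · refine Finset.sum_congr rfl fun a _ => ?_
    split_ifs with h
    · rw [ENNReal.ofReal_mul (Real.exp_pos _).le]
    · simp
  · intro a _
    split_ifs with h
    · exact mul_nonneg (Real.exp_pos _).le (hf0 _)
    · rfl

lemma ruelleR_sub {f g : MShift Adj → ℝ} (hf : HasCompactSupport f) (hg : HasCompactSupport g)
    (x : MShift Adj) :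
    RuelleR Adj φ (f - g) x = RuelleR Adj φ f x - RuelleR Adj φ g x := by
  have hs : ∀ {h : MShift Adj → ℝ}, HasCompactSupport h → Summable
      fun y : {y : MShift Adj // shiftMap Adj y = x} => Real.exp (φ y.1) * h y.1 := by
    intro h hh
    refine summable_of_hasFiniteSupport ?_
    refine Set.Finite.of_finite_image ((finite_suppLetters hh).subset ?_)
      (f := fun y : {y : MShift Adj // shiftMap Adj y = x} => y.1.1 0) ?_
    · rintro _ ⟨y, hy, rfl⟩
      by_contra hne
      exact hy (by simp [eq_zero_of_notMem_suppLetters hne])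
    · rintro ⟨y, rfl⟩ - ⟨z, hz⟩ - h0
      apply Subtype.ext
      change y = z
      rw [← cons_shiftMap y, ← cons_shiftMap z]
      congr 1
      exact hz.symm
  unfold RuelleR
  rw [← (hs hf).tsum_sub (hs hg)]
  exact tsum_congr fun y => by simp [mul_sub]

lemma continuous_ruelleR (hvar : SummableVar Adj φ) {f : MShift Adj → ℝ} (hf : Continuous f)
    (hfc : HasCompactSupport f) : Continuous (RuelleR Adj φ f) := by
  classical
  simp_rw [funext (ruelleR_eq_sum (φ := φ) hfc)]
  refine continuous_finsetSum _ fun a _ => continuous_iff_continuousAt.2 fun x => ?_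
  have hclopen := isClopen_setOf_zero (Adj := Adj) (Adj a)
  by_cases hx : Adj a (x.1 0)
  · refine ContinuousOn.continuousAt ?_ (hclopen.isOpen.mem_nhds hx)
    rw [continuousOn_iff_continuous_domRestrict]
    have : Continuous fun y : {y : MShift Adj // Adj a (y.1 0)} =>
        Real.exp (φ (cons a y.1 y.2)) * f (cons a y.1 y.2) :=
      (Real.continuous_exp.comp ((continuous_potential hvar).comp (continuous_cons a))).mul
        (hf.comp (continuous_cons a))
    refine this.congr fun y => ?_
    have hy : Adj a (y.1.1 0) := y.2
    simp only [Set.domRestrict_apply, dif_pos hy]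
  · refine (continuousAt_const (y := (0 : ℝ))).congr ?_
    filter_upwards [hclopen.compl.isOpen.mem_nhds hx] with y hy
    have hy' : ¬ Adj a (y.1 0) := hy
    simp only [dif_neg hy']

lemma hasCompactSupport_ruelleR (hloc : LocFin Adj) {f : MShift Adj → ℝ}
    (hfc : HasCompactSupport f) : HasCompactSupport (RuelleR Adj φ f) := by
  classical
  refine HasCompactSupport.intro (isCompact_setOf_zero_mem hloc
    ((finite_suppLetters hfc).biUnion fun a _ => hloc a)) fun x hx => ?_
  rw [ruelleR_eq_sum hfc]
  refine Finset.sum_eq_zero fun a ha => dif_neg fun h => hx ?_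
  exact Set.mem_biUnion ((Set.Finite.mem_toFinset _).1 ha) h

end Topology

section Kernel

variable {Adj : S → S → Prop} [MeasurableSpace S]

/-- The measure `f ↦ (L_φⁿ f)(x)`. -/
noncomputable def iterMeasure (φ : MShift Adj → ℝ) : ℕ → MShift Adj → Measure (MShift Adj)
  | 0, x => Measure.dirac x
  | n + 1, x => Measure.sum fun y : {y : MShift Adj // shiftMap Adj y = x} =>
      ENNReal.ofReal (Real.exp (φ y.1)) • iterMeasure φ n y.1

lemma lintegral_iterMeasure (φ : MShift Adj → ℝ) {f : MShift Adj → ℝ≥0∞} (hf : Measurable f)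
    (n : ℕ) (x : MShift Adj) :
    ∫⁻ y, f y ∂(iterMeasure φ n x) = ((Ruelle Adj φ)^[n] f) x := by
  induction n generalizing x with
  | zero => exact lintegral_dirac' x hf
  | succ n ih =>
    rw [Function.iterate_succ_apply', iterMeasure, lintegral_sum_measure]
    exact tsum_congr fun y => by rw [lintegral_smul_measure, ih, smul_eq_mul]

/-- The measure `f ↦ K(f, x | λ)`. -/
noncomputable def martinMeasure (φ : MShift Adj → ℝ) (lam : ℝ) (o : S) (x : MShift Adj) :
    Measure (MShift Adj) :=
  (Green Adj φ lam (cylInd Adj o) x)⁻¹ •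
    Measure.sum fun n : ℕ => ENNReal.ofReal ((lam ^ n)⁻¹) • iterMeasure φ n x

lemma lintegral_martinMeasure (φ : MShift Adj → ℝ) (lam : ℝ) (o : S) (x : MShift Adj)
    {f : MShift Adj → ℝ≥0∞} (hf : Measurable f) :
    ∫⁻ y, f y ∂(martinMeasure φ lam o x) =
      Green Adj φ lam f x / Green Adj φ lam (cylInd Adj o) x := by
  rw [martinMeasure, lintegral_smul_measure, lintegral_sum_measure, div_eq_mul_inv,
    smul_eq_mul, mul_comm]
  congr 1
  exact tsum_congr fun n => by rw [lintegral_smul_measure, lintegral_iterMeasure φ hf, smul_eq_mul]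

lemma martinMeasure_apply (φ : MShift Adj → ℝ) (lam : ℝ) (o : S) (x : MShift Adj)
    {B : Set (MShift Adj)} (hB : MeasurableSet B) :
    martinMeasure φ lam o x B =
      Green Adj φ lam (B.indicator 1) x / Green Adj φ lam (cylInd Adj o) x := by
  rw [← lintegral_martinMeasure φ lam o x (measurable_one.indicator hB), lintegral_indicator_one hB]

end Kernel

section VagueLimit

variable {Adj : S → S → Prop}

lemma cylA_eq_cylSigma (a : S) : cylA Adj a = cylSigma Adj ⟨0, fun _ => a⟩ := by
  ext x
  simp [cylA, cylSigma]

variable [TopologicalSpace S] [DiscreteTopology S]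

lemma isClopen_cylSigma (w : (m : ℕ) × (Fin (m + 1) → S)) : IsClopen (cylSigma Adj w) := by
  have hcont : Continuous fun (x : MShift Adj) (i : Fin (w.1 + 1)) => x.1 i :=
    continuous_pi fun i => (continuous_apply (i : ℕ)).comp continuous_subtype_val
  have : cylSigma Adj w = (fun (x : MShift Adj) (i : Fin (w.1 + 1)) => x.1 i) ⁻¹'
      {v | v = w.2} := by
    ext x
    simp [cylSigma, funext_iff]
  rw [this]
  exact (isClopen_discrete _).preimage hcont

variable [MeasurableSpace S]

lemma isFiniteMeasureOnCompacts_of_cylSigma {ν : Measure (MShift Adj)}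
    (hν : ∀ w, ν (cylSigma Adj w) ≠ ⊤) : IsFiniteMeasureOnCompacts ν := by
  refine ⟨fun K hK => ?_⟩
  have hsub : K ⊆ ⋃ a ∈ (fun x : MShift Adj => x.1 0) '' K, cylA Adj a := fun x hx =>
    Set.mem_biUnion ⟨x, hx, rfl⟩ rfl
  refine (measure_mono hsub).trans_lt (measure_biUnion_lt_top (finite_image_zero hK) ?_)
  intro a _
  rw [cylA_eq_cylSigma]
  exact (hν _).lt_top

variable [Countable S] [MeasurableSingletonClass S]

lemma exists_tendsto_integral (hloc : LocFin Adj) {ν : ℕ → Measure (MShift Adj)}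
    (hν : ∀ n w, ν n (cylSigma Adj w) ≠ ⊤)
    (hlim : ∀ w, ∃ l, Tendsto (fun n => (ν n).real (cylSigma Adj w)) atTop (𝓝 l))
    {f : MShift Adj → ℝ} (hf : Continuous f) (hfc : HasCompactSupport f) :
    ∃ l, Tendsto (fun n => ∫ x, f x ∂(ν n)) atTop (𝓝 l) := by
  classical
  have hfin := fun n => isFiniteMeasureOnCompacts_of_cylSigma (hν n)
  choose l hl using hlim
  set A := suppLetters f
  have hA : A.Finite := finite_suppLetters hfc
  set X : Set (MShift Adj) := {x | x.1 0 ∈ A}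
  have hX : IsCompact X := isCompact_setOf_zero_mem hloc hA
  have hXm : MeasurableSet X := hX.measurableSet
  obtain ⟨M, hM⟩ : ∃ M, ∀ n, (ν n).real X ≤ M := by
    have hsum : Tendsto (fun n => ∑ a ∈ hA.toFinset, (ν n).real (cylSigma Adj ⟨0, fun _ => a⟩))
        atTop (𝓝 (∑ a ∈ hA.toFinset, l ⟨0, fun _ => a⟩)) := tendsto_finsetSum _ fun a _ => hl _
    obtain ⟨M, hM⟩ := hsum.bddAbove_range
    refine ⟨M, fun n => le_trans ?_ (hM ⟨n, rfl⟩)⟩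
    have hXeq : X = ⋃ a ∈ hA.toFinset, cylSigma Adj ⟨0, fun _ => a⟩ := by
      ext x
      simp [X, ← cylA_eq_cylSigma, cylA]
    rw [hXeq]
    exact measureReal_biUnion_finset_le _ _
  have hM0 : 0 ≤ M := measureReal_nonneg.trans (hM 0)
  have approx : ∀ ε > 0, ∃ b : ℕ → ℝ, CauchySeq b ∧ ∀ n, |∫ x, f x ∂(ν n) - b n| ≤ ε * M := by
    intro ε hε
    obtain ⟨k, hk⟩ := exists_uniform_cylinder hf hfc hloc hε
    let r : MShift Adj → (Fin (k + 1) → S) := fun x i => x.1 i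
    have hr : Continuous r :=
      continuous_pi fun i => (continuous_apply (i : ℕ)).comp continuous_subtype_val
    have hW : (r '' X).Finite := (hX.image hr).finite_of_discrete
    let c : (Fin (k + 1) → S) → ℝ := fun w => if h : ∃ x ∈ X, r x = w then f h.choose else 0
    let g : MShift Adj → ℝ := fun x =>
      ∑ w ∈ hW.toFinset, (cylSigma Adj ⟨k, w⟩).indicator (fun _ => c w) x
    have hmem : ∀ x w, x ∈ cylSigma Adj ⟨k, w⟩ ↔ r x = w := fun x w => by
      simp [cylSigma, r, funext_iff]
    have hgint : ∀ n w, Integrable ((cylSigma Adj ⟨k, w⟩).indicator fun _ => c w) (ν n) :=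
      fun n w => (integrable_indicator_iff (isClopen_cylSigma _).isOpen.measurableSet).2
        (integrableOn_const (hν n _))
    have hg : ∀ n, ∫ x, g x ∂(ν n) =
        ∑ w ∈ hW.toFinset, (ν n).real (cylSigma Adj ⟨k, w⟩) * c w := by
      intro n
      rw [integral_finsetSum _ fun w _ => hgint n w]
      refine Finset.sum_congr rfl fun w _ => ?_
      rw [integral_indicator_const _ (isClopen_cylSigma _).isOpen.measurableSet, smul_eq_mul]
    refine ⟨fun n => ∫ x, g x ∂(ν n), ?_, fun n => ?_⟩
    · simp_rw [hg]
      exact (tendsto_finsetSum _ fun w _ => (hl ⟨k, w⟩).mul_const (c w)).cauchySeq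
    · have hfi : Integrable f (ν n) := hf.integrable_of_hasCompactSupport hfc
      have hgi : Integrable g (ν n) := integrable_finsetSum _ fun w _ => hgint n w
      have hpt : ∀ x, |f x - g x| ≤ X.indicator (fun _ => ε) x := by
        intro x
        by_cases hx : x ∈ X
        · rw [Set.indicator_of_mem hx]
          have hgx : g x = c (r x) := by
            have hrx : r x ∈ hW.toFinset := (Set.Finite.mem_toFinset _).2 ⟨x, hx, rfl⟩
            refine (Finset.sum_eq_single_of_mem (r x) hrx ?_).trans ?_
            rotate_left
            · exact Set.indicator_of_mem ((hmem _ _).2 rfl) _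
            · exact fun w _ hw => Set.indicator_of_notMem (fun h => hw ((hmem _ _).1 h).symm) _
          have hex : ∃ y ∈ X, r y = r x := ⟨x, hx, rfl⟩
          have hcx : c (r x) = f hex.choose := dif_pos hex
          rw [hgx, hcx]
          refine (hk _ _ fun i hi => ?_).le
          exact (congrFun hex.choose_spec.2 ⟨i, hi⟩).symm
        · rw [Set.indicator_of_notMem hx]
          have hgx : g x = 0 := by
            refine Finset.sum_eq_zero fun w hw => Set.indicator_of_notMem (fun h => hx ?_) _
            obtain ⟨y, hy, hyw⟩ := (Set.Finite.mem_toFinset _).1 hw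
            have h0 : y.1 0 = x.1 0 := congrFun (hyw.trans ((hmem _ _).1 h).symm) 0
            change x.1 0 ∈ A
            rw [← h0]
            exact hy
          rw [hgx, eq_zero_of_notMem_suppLetters (f := f) hx]
          simp
      rw [← integral_sub hfi hgi]
      calc |∫ x, (f x - g x) ∂(ν n)| ≤ ∫ x, |f x - g x| ∂(ν n) := abs_integral_le_integral_abs
        _ ≤ ∫ x, X.indicator (fun _ => ε) x ∂(ν n) :=
            integral_mono (hfi.sub hgi).abs ((integrable_indicator_iff hXm).2
              (integrableOn_const hX.measure_lt_top.ne)) hpt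
        _ = (ν n).real X * ε := by rw [integral_indicator_const _ hXm, smul_eq_mul]
        _ ≤ ε * M := by rw [mul_comm]; exact mul_le_mul_of_nonneg_left (hM n) hε.le
  refine cauchySeq_tendsto_of_complete (Metric.cauchySeq_iff.2 fun ε hε => ?_)
  obtain ⟨b, hb, hab⟩ := approx (ε / (3 * (M + 1))) (by positivity)
  have hsmall : ε / (3 * (M + 1)) * M < ε / 3 := by
    rw [div_mul_eq_mul_div, div_lt_div_iff₀ (by positivity) (by positivity)]
    nlinarith
  obtain ⟨N, hN⟩ := Metric.cauchySeq_iff.1 hb (ε / 3) (by positivity)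
  refine ⟨N, fun m hm n hn => ?_⟩
  have h1 := hab m
  have h2 := hab n
  have h3 := hN m hm n hn
  rw [Real.dist_eq, abs_lt] at *
  rw [abs_le] at *
  constructor <;> linarith

/-- A sequence of measures whose values on all cylinders converge has a vague limit. -/
lemma exists_vague_limit (hloc : LocFin Adj) {ν : ℕ → Measure (MShift Adj)}
    (hν : ∀ n w, ν n (cylSigma Adj w) ≠ ⊤)
    (hlim : ∀ w, ∃ l, Tendsto (fun n => (ν n).real (cylSigma Adj w)) atTop (𝓝 l)) :
    ∃ μ : Measure (MShift Adj), μ.Regular ∧ ∀ f : MShift Adj → ℝ, Continuous f →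
      HasCompactSupport f → Tendsto (fun n => ∫ x, f x ∂(ν n)) atTop (𝓝 (∫ x, f x ∂μ)) := by
  have hfin := fun n => isFiniteMeasureOnCompacts_of_cylSigma (hν n)
  have := locallyCompactSpace hloc
  have hex : ∀ f : CompactlySupportedContinuousMap (MShift Adj) ℝ,
      ∃ l, Tendsto (fun n => ∫ x, f x ∂(ν n)) atTop (𝓝 l) := fun f =>
    exists_tendsto_integral hloc hν hlim f.continuous f.hasCompactSupport
  choose Λ hΛ using hex
  have hint : ∀ n (f : CompactlySupportedContinuousMap (MShift Adj) ℝ), Integrable f (ν n) :=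
    fun n f => f.continuous.integrable_of_hasCompactSupport f.hasCompactSupport
  let L : CompactlySupportedContinuousMap (MShift Adj) ℝ →ₗ[ℝ] ℝ :=
    { toFun := Λ
      map_add' := fun f g => tendsto_nhds_unique (hΛ (f + g)) (by
        refine ((hΛ f).add (hΛ g)).congr fun n => ?_
        rw [← integral_add (hint n f) (hint n g)]
        rfl)
      map_smul' := fun c f => tendsto_nhds_unique (hΛ (c • f)) (by
        refine ((hΛ f).const_mul c).congr fun n => ?_
        rw [← integral_const_mul]
        rfl) }
  refine ⟨RealRMK.rieszMeasure (PositiveLinearMap.mk₀ L fun f hf =>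
    ge_of_tendsto' (hΛ f) fun n => integral_nonneg hf), inferInstance, fun f hf hfc => ?_⟩
  have := RealRMK.integral_rieszMeasure (PositiveLinearMap.mk₀ L fun f hf =>
    ge_of_tendsto' (hΛ f) fun n => integral_nonneg hf) ⟨⟨f, hf⟩, hfc⟩
  exact this ▸ hΛ ⟨⟨f, hf⟩, hfc⟩

end VagueLimit

section MartinMetric

variable {Adj : S → S → Prop} {φ : MShift Adj → ℝ} {lam : ℝ} {o : S}
  {e : ℕ → (m : ℕ) × (Fin (m + 1) → S)} {C : ℕ → ℝ}

lemma abs_indicator_sub_indicator_le (B : Set (MShift Adj)) (x y : MShift Adj) :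
    |Set.indicator B (fun _ => (1 : ℝ)) x - Set.indicator B (fun _ => (1 : ℝ)) y| ≤ 1 := by
  by_cases hx : x ∈ B <;> by_cases hy : y ∈ B <;> simp [hx, hy]

lemma bound_add_one_pos
    (hC : ∀ (i : ℕ) (x : MShift Adj), MartinKr Adj φ lam o (cylSigma Adj (e i)) x ≤ C i)
    (x : MShift Adj) (i : ℕ) : 0 < C i + 1 := by
  have h : 0 ≤ MartinKr Adj φ lam o (cylSigma Adj (e i)) x := ENNReal.toReal_nonneg
  linarith [hC i x]

lemma martinRho_term_le
    (hC : ∀ (i : ℕ) (x : MShift Adj), MartinKr Adj φ lam o (cylSigma Adj (e i)) x ≤ C i)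
    (x y : MShift Adj) (i : ℕ) :
    ((2 : ℝ) ^ i * (C i + 1))⁻¹ *
    (|MartinKr Adj φ lam o (cylSigma Adj (e i)) x -
        MartinKr Adj φ lam o (cylSigma Adj (e i)) y| +
      |Set.indicator (cylSigma Adj (e i)) (fun _ => (1 : ℝ)) x -
        Set.indicator (cylSigma Adj (e i)) (fun _ => (1 : ℝ)) y|) ≤ (1 / 2) ^ i := by
  have hx0 : 0 ≤ MartinKr Adj φ lam o (cylSigma Adj (e i)) x := ENNReal.toReal_nonneg
  have hy0 : 0 ≤ MartinKr Adj φ lam o (cylSigma Adj (e i)) y := ENNReal.toReal_nonneg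
  have hpos : 0 < C i + 1 := bound_add_one_pos hC x i
  have h1 : |MartinKr Adj φ lam o (cylSigma Adj (e i)) x -
      MartinKr Adj φ lam o (cylSigma Adj (e i)) y| ≤ C i :=
    abs_le.2 ⟨by linarith [hC i y], by linarith [hC i x]⟩
  have h2 := abs_indicator_sub_indicator_le (cylSigma Adj (e i)) x y
  rw [inv_mul_le_iff₀ (by positivity)]
  calc _ ≤ C i + 1 := add_le_add h1 h2
    _ = _ := by
      rw [mul_right_comm, ← mul_pow]
      norm_num

lemma martinRho_term_nonneg
    (hC : ∀ (i : ℕ) (x : MShift Adj), MartinKr Adj φ lam o (cylSigma Adj (e i)) x ≤ C i)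
    (x y : MShift Adj) (i : ℕ) :
    0 ≤ ((2 : ℝ) ^ i * (C i + 1))⁻¹ *
    (|MartinKr Adj φ lam o (cylSigma Adj (e i)) x -
        MartinKr Adj φ lam o (cylSigma Adj (e i)) y| +
      |Set.indicator (cylSigma Adj (e i)) (fun _ => (1 : ℝ)) x -
        Set.indicator (cylSigma Adj (e i)) (fun _ => (1 : ℝ)) y|) := by
  have hpos : 0 < C i + 1 := bound_add_one_pos hC x i
  positivity

/-- The Martin metric dominates each of its coordinates, up to a constant. -/
lemma add_le_mul_martinRho
    (hC : ∀ (i : ℕ) (x : MShift Adj), MartinKr Adj φ lam o (cylSigma Adj (e i)) x ≤ C i)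
    (x y : MShift Adj) (i : ℕ) :
    |MartinKr Adj φ lam o (cylSigma Adj (e i)) x -
        MartinKr Adj φ lam o (cylSigma Adj (e i)) y| +
      |Set.indicator (cylSigma Adj (e i)) (fun _ => (1 : ℝ)) x -
        Set.indicator (cylSigma Adj (e i)) (fun _ => (1 : ℝ)) y| ≤
      ((2 : ℝ) ^ i * (C i + 1)) * martinRho Adj φ lam o e C x y := by
  have hpos : 0 < C i + 1 := bound_add_one_pos hC x i
  rw [← inv_mul_le_iff₀ (by positivity)]
  exact (Summable.of_nonneg_of_le (martinRho_term_nonneg hC x y) (martinRho_term_le hC x y)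
    summable_geometric_two).le_tsum i fun j _ => martinRho_term_nonneg hC x y j

lemma RhoCauchy.eventually_lt {u : ℕ → MShift Adj} (hu : RhoCauchy Adj φ lam o e C u)
    (hC : ∀ (i : ℕ) (x : MShift Adj), MartinKr Adj φ lam o (cylSigma Adj (e i)) x ≤ C i)
    (i : ℕ) {ε : ℝ} (hε : 0 < ε) : ∃ N : ℕ, ∀ m ≥ N, ∀ n ≥ N,
    |MartinKr Adj φ lam o (cylSigma Adj (e i)) (u m) -
        MartinKr Adj φ lam o (cylSigma Adj (e i)) (u n)| +
      |Set.indicator (cylSigma Adj (e i)) (fun _ => (1 : ℝ)) (u m) -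
        Set.indicator (cylSigma Adj (e i)) (fun _ => (1 : ℝ)) (u n)| < ε := by
  have hpos : 0 < C i + 1 := bound_add_one_pos hC (u 0) i
  obtain ⟨N, hN⟩ := hu (((2 : ℝ) ^ i * (C i + 1))⁻¹ * ε) (by positivity)
  refine ⟨N, fun m hm n hn => (add_le_mul_martinRho hC _ _ i).trans_lt ?_⟩
  rw [← lt_inv_mul_iff₀ (by positivity)]
  exact hN m hm n hn

lemma RhoCauchy.exists_tendsto_martinKr {u : ℕ → MShift Adj}
    (hu : RhoCauchy Adj φ lam o e C u) (he : Function.Surjective e)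
    (hC : ∀ (i : ℕ) (x : MShift Adj), MartinKr Adj φ lam o (cylSigma Adj (e i)) x ≤ C i)
    (w : (m : ℕ) × (Fin (m + 1) → S)) :
    ∃ l, Tendsto (fun n => MartinKr Adj φ lam o (cylSigma Adj w) (u n)) atTop (𝓝 l) := by
  obtain ⟨i, rfl⟩ := he w
  refine cauchySeq_tendsto_of_complete (Metric.cauchySeq_iff.2 fun ε hε => ?_)
  obtain ⟨N, hN⟩ := hu.eventually_lt hC i hε
  exact ⟨N, fun m hm n hn =>
    lt_of_le_of_lt (le_add_of_nonneg_right (abs_nonneg _)) (hN m hm n hn)⟩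

lemma RhoCauchy.eventually_mem_of_frequently {u : ℕ → MShift Adj}
    (hu : RhoCauchy Adj φ lam o e C u) (he : Function.Surjective e)
    (hC : ∀ (i : ℕ) (x : MShift Adj), MartinKr Adj φ lam o (cylSigma Adj (e i)) x ≤ C i)
    (w : (m : ℕ) × (Fin (m + 1) → S)) (hw : ∃ᶠ n in atTop, u n ∈ cylSigma Adj w) :
    ∀ᶠ n in atTop, u n ∈ cylSigma Adj w := by
  obtain ⟨i, rfl⟩ := he w
  obtain ⟨N, hN⟩ := hu.eventually_lt hC i one_pos
  obtain ⟨m, hm, hmN⟩ := (hw.and_eventually (eventually_ge_atTop N)).exists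
  filter_upwards [eventually_ge_atTop N] with n hn
  by_contra hmem
  have h := lt_of_le_of_lt (le_add_of_nonneg_left (abs_nonneg _)) (hN m hmN n hn)
  simp [hm, hmem] at h

lemma green_indicator_cylSigma_ne_top (htransient : Transient Adj φ lam)
    (w : (m : ℕ) × (Fin (m + 1) → S)) (x : MShift Adj) :
    Green Adj φ lam ((cylSigma Adj w).indicator 1) x ≠ ⊤ := by
  refine ne_top_of_le_ne_top (htransient (w.2 0) x) (green_mono ?_ x)
  exact Set.indicator_le_indicator_of_subset (fun y hy => hy 0) fun _ => zero_le

lemma rhoTendsto_of_eventually_eq (htrans : TransitiveShift Adj) (hvar : SummableVar Adj φ)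
    (hlam : 0 < lam) (htransient : Transient Adj φ lam)
    (hC : ∀ (i : ℕ) (x : MShift Adj), MartinKr Adj φ lam o (cylSigma Adj (e i)) x ≤ C i)
    {u : ℕ → MShift Adj} {x : MShift Adj}
    (hu : ∀ k, ∀ᶠ n in atTop, ∀ i < k, (u n).1 i = x.1 i) :
    RhoTendsto Adj φ lam o e C u x := by
  have hmem : ∀ (w : (m : ℕ) × (Fin (m + 1) → S)) (y z : MShift Adj),
      (∀ i < w.1 + 1, y.1 i = z.1 i) → (y ∈ cylSigma Adj w ↔ z ∈ cylSigma Adj w) :=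
    fun w y z h => forall_congr' fun i => by rw [h i i.2]
  have hlocal : ∀ (w : (m : ℕ) × (Fin (m + 1) → S)) (y z : MShift Adj),
      (∀ i < w.1 + 1, y.1 i = z.1 i) →
      (cylSigma Adj w).indicator (1 : MShift Adj → ℝ≥0∞) y = (cylSigma Adj w).indicator 1 z := by
    intro w y z h
    have := hmem w y z h
    by_cases hz : z ∈ cylSigma Adj w <;> simp [this, hz]
  have hnum := fun w => tendsto_green hvar (hlocal w)
    (green_indicator_cylSigma_ne_top htransient w) hu
  have hden := tendsto_green (lam := lam) (f := cylInd Adj o) (m := 1) hvar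
    (by
      rw [cylInd, cylA_eq_cylSigma]
      exact hlocal ⟨0, fun _ => o⟩)
    (htransient o) hu
  have hne : (Green Adj φ lam (cylInd Adj o) x).toReal ≠ 0 :=
    ENNReal.toReal_ne_zero.2 ⟨green_cylInd_ne_zero htrans hlam o x, htransient o x⟩
  have hK : ∀ w, Tendsto (fun n => MartinKr Adj φ lam o (cylSigma Adj w) (u n)) atTop
      (𝓝 (MartinKr Adj φ lam o (cylSigma Adj w) x)) := by
    intro w
    simp only [MartinKr, ENNReal.toReal_div]
    exact (hnum w).div hden hne
  have hI : ∀ w, Tendsto (fun n => Set.indicator (cylSigma Adj w) (fun _ => (1 : ℝ)) (u n))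
      atTop (𝓝 (Set.indicator (cylSigma Adj w) (fun _ => (1 : ℝ)) x)) := by
    intro w
    refine tendsto_const_nhds.congr' ?_
    filter_upwards [hu (w.1 + 1)] with n hn
    have := hmem w _ _ hn
    by_cases hz : x ∈ cylSigma Adj w <;> simp [this, hz]
  unfold RhoTendsto martinRho
  rw [← tsum_zero (β := ℕ) (α := ℝ)]
  refine tendsto_tsum_of_dominated_convergence (bound := fun i => (1 / 2 : ℝ) ^ i)
    summable_geometric_two (fun i => ?_) (Eventually.of_forall fun n i => ?_)
  · have h1 := ((hK (e i)).sub_const (MartinKr Adj φ lam o (cylSigma Adj (e i)) x)).abs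
    have h2 := ((hI (e i)).sub_const
      (Set.indicator (cylSigma Adj (e i)) (fun _ => (1 : ℝ)) x)).abs
    simpa using (h1.add h2).const_mul ((2 : ℝ) ^ i * (C i + 1))⁻¹
  · rw [Real.norm_of_nonneg (martinRho_term_nonneg hC _ _ i)]
    exact martinRho_term_le hC _ _ i

/-- A Martin-Cauchy sequence without limit in the shift space eventually leaves every `[a]`. -/
lemma eventually_zero_ne [TopologicalSpace S] [DiscreteTopology S]
    (htrans : TransitiveShift Adj) (hloc : LocFin Adj) (hvar : SummableVar Adj φ)
    (hlam : 0 < lam) (htransient : Transient Adj φ lam) (he : Function.Surjective e)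
    (hC : ∀ (i : ℕ) (x : MShift Adj), MartinKr Adj φ lam o (cylSigma Adj (e i)) x ≤ C i)
    {u : ℕ → MShift Adj} (hu : RhoCauchy Adj φ lam o e C u)
    (hbd : ¬∃ x : MShift Adj, RhoTendsto Adj φ lam o e C u x) (a : S) :
    ∀ᶠ n in atTop, (u n).1 0 ≠ a := by
  by_contra hcon
  have hfreq : ∃ᶠ n in atTop, u n ∈ {x : MShift Adj | x.1 0 ∈ ({a} : Set S)} :=
    fun h => hcon (h.mono fun n hn => hn)
  obtain ⟨x, -, hx⟩ := (isCompact_setOf_zero_mem hloc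
    (Set.finite_singleton a)).exists_mapClusterPt_of_frequently hfreq
  refine hbd ⟨x, rhoTendsto_of_eventually_eq htrans hvar hlam htransient hC fun k => ?_⟩
  have hmem : ∃ᶠ n in atTop, u n ∈ cylSigma Adj ⟨k, fun i => x.1 i⟩ :=
    hx.frequently ((isClopen_cylSigma _).isOpen.mem_nhds fun i => rfl)
  filter_upwards [hu.eventually_mem_of_frequently he hC _ hmem] with n hn i hi
  exact hn ⟨i, Nat.lt_succ_of_lt hi⟩

end MartinMetric

lemma toReal_green_div_eq_integral {Adj : S → S → Prop} [TopologicalSpace S] [DiscreteTopology S]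
    [Countable S] [MeasurableSpace S] [MeasurableSingletonClass S] (φ : MShift Adj → ℝ) (lam : ℝ)
    (o : S) (x : MShift Adj) {f : MShift Adj → ℝ} (hf : Continuous f) (hf0 : 0 ≤ f) :
    (Green Adj φ lam (ofRG f) x / Green Adj φ lam (cylInd Adj o) x).toReal =
      ∫ y, f y ∂(martinMeasure φ lam o x) := by
  rw [integral_eq_lintegral_of_nonneg_ae (Eventually.of_forall hf0)
    hf.measurable.aestronglyMeasurable,
    lintegral_martinMeasure φ lam o x hf.measurable.ennreal_ofReal]
  rfl

/-- For every boundary point `ω` of the Martin compactification — represented by a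
`ρ`-Cauchy sequence `u` with no limit in `X⁺` — the limits `μ_ω(f) = lim_{x→ω} K(f,x|λ)`
exist for all `f ∈ C_c(X⁺)` and define a non-zero positive Radon measure `μ_ω` which is
`λ`-conformal.  In particular there exists a non-zero Radon measure `μ` with
`L_φ* μ = λ μ`. -/
theorem boundary_point_conformal_measure [Countable S] [MeasurableSpace S]
    [MeasurableSingletonClass S] [TopologicalSpace S] [DiscreteTopology S]
    (Adj : S → S → Prop) (htrans : TransitiveShift Adj) (hloc : LocFin Adj)
    (φ : MShift Adj → ℝ) (hvar : SummableVar Adj φ) (lam : ℝ) (hlam : 0 < lam)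
    (htransient : Transient Adj φ lam) (o : S)
    (e : ℕ → (m : ℕ) × (Fin (m + 1) → S)) (he : Function.Surjective e)
    (C : ℕ → ℝ) (hC : ∀ (i : ℕ) (x : MShift Adj),
      MartinKr Adj φ lam o (cylSigma Adj (e i)) x ≤ C i)
    (u : ℕ → MShift Adj) (hu : RhoCauchy Adj φ lam o e C u)
    (hbd : ¬∃ x : MShift Adj, RhoTendsto Adj φ lam o e C u x) :
    ∃ μ : Measure (MShift Adj),
      (∀ K : Set (MShift Adj), IsCompact K → μ K ≠ ⊤) ∧
      μ ≠ 0 ∧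
      (∀ f : MShift Adj → ℝ, Continuous f → HasCompactSupport f → 0 ≤ f →
        Filter.Tendsto
          (fun n => (Green Adj φ lam (ofRG f) (u n) /
            Green Adj φ lam (cylInd Adj o) (u n)).toReal)
          Filter.atTop (nhds (∫ x, f x ∂μ))) ∧
      (∀ f : MShift Adj → ℝ, Continuous f → HasCompactSupport f →
        ∫ x, RuelleR Adj φ f x ∂μ = lam * ∫ x, f x ∂μ) := by
  have hpos := fun x => green_cylInd_ne_zero (φ := φ) htrans hlam o x
  have hcyl : ∀ (n : ℕ) (w : (m : ℕ) × (Fin (m + 1) → S)),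
      martinMeasure φ lam o (u n) (cylSigma Adj w) =
        Green Adj φ lam ((cylSigma Adj w).indicator 1) (u n) /
          Green Adj φ lam (cylInd Adj o) (u n) := fun n w =>
    martinMeasure_apply φ lam o (u n) (isClopen_cylSigma w).isOpen.measurableSet
  obtain ⟨μ, hμ, hμlim⟩ := exists_vague_limit hloc
    (ν := fun n => martinMeasure φ lam o (u n))
    (fun n w => by
      rw [hcyl]
      exact ENNReal.div_ne_top (green_indicator_cylSigma_ne_top htransient w _) (hpos _))
    (fun w => by
      simp only [Measure.real, hcyl]
      exact hu.exists_tendsto_martinKr he hC w)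
  have hlim : ∀ f : MShift Adj → ℝ, Continuous f → HasCompactSupport f → 0 ≤ f →
      Tendsto (fun n => (Green Adj φ lam (ofRG f) (u n) /
        Green Adj φ lam (cylInd Adj o) (u n)).toReal) atTop (𝓝 (∫ x, f x ∂μ)) := by
    intro f hf hfc hf0
    simp_rw [toReal_green_div_eq_integral φ lam o _ hf hf0]
    exact hμlim f hf hfc
  have hesc := eventually_zero_ne htrans hloc hvar hlam htransient he hC hu hbd
  have hconf : ∀ f : MShift Adj → ℝ, Continuous f → HasCompactSupport f → 0 ≤ f →
      ∫ x, RuelleR Adj φ f x ∂μ = lam * ∫ x, f x ∂μ := by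
    intro f hf hfc hf0
    refine tendsto_nhds_unique (hlim _ (continuous_ruelleR hvar hf hfc)
      (hasCompactSupport_ruelleR hloc hfc) (ruelleR_nonneg hf0))
      (((hlim f hf hfc hf0).const_mul lam).congr' ?_)
    have hout : ∀ᶠ n in atTop, ∀ a ∈ suppLetters f, (u n).1 0 ≠ a :=
      (eventually_all_finite (finite_suppLetters hfc)).2 fun a _ => hesc a
    filter_upwards [hout] with n hn
    have hzero : ofRG f (u n) = 0 := by
      rw [ofRG, eq_zero_of_notMem_suppLetters (f := f) fun h => hn _ h rfl, ENNReal.ofReal_zero]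
    rw [green_eq_add hlam, hzero, zero_add, ruelle_ofRG hfc hf0, mul_div_assoc,
      ENNReal.toReal_mul, ENNReal.toReal_ofReal (by positivity), mul_inv_cancel_left₀ hlam.ne']
  refine ⟨μ, fun K hK => hK.measure_lt_top.ne, ?_, hlim, fun f hf hfc => ?_⟩
  · rintro rfl
    have hclopen : IsClopen (cylA Adj o) := cylA_eq_cylSigma (Adj := Adj) o ▸ isClopen_cylSigma _
    have hcpt : HasCompactSupport ((cylA Adj o).indicator fun _ => (1 : ℝ)) :=
      HasCompactSupport.intro (isCompact_setOf_zero_mem hloc (Set.finite_singleton o))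
        fun x hx => Set.indicator_of_notMem hx _
    have h := hlim _ (continuous_const.indicator
      (by simp [hclopen.frontier_eq])) hcpt (Set.indicator_nonneg fun _ _ => zero_le_one)
    have hind : ofRG ((cylA Adj o).indicator fun _ => (1 : ℝ)) = cylInd Adj o := by
      funext x
      by_cases hx : x ∈ cylA Adj o <;> simp [ofRG, cylInd, hx]
    simp only [hind, ENNReal.div_self (hpos _) (htransient o _), ENNReal.toReal_one,
      integral_zero_measure] at h
    exact one_ne_zero (tendsto_nhds_unique tendsto_const_nhds h)
  · have hp : Continuous fun x => max (f x) 0 := hf.max continuous_const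
    have hm : Continuous fun x => max (-f x) 0 := hf.neg.max continuous_const
    have hpc : HasCompactSupport fun x => max (f x) 0 :=
      hfc.comp_left (g := fun t : ℝ => max t 0) (by simp)
    have hmc : HasCompactSupport fun x => max (-f x) 0 :=
      hfc.comp_left (g := fun t : ℝ => max (-t) 0) (by simp)
    have hdecomp : f = (fun x => max (f x) 0) - fun x => max (-f x) 0 := by
      funext x
      rcases le_total (f x) 0 with h | h <;> simp [h]
    have hint : ∀ {g : MShift Adj → ℝ}, Continuous g → HasCompactSupport g → Integrable g μ :=
      fun hg hgc => hg.integrable_of_hasCompactSupport hgc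
    have hR : ∀ x, RuelleR Adj φ f x = RuelleR Adj φ (fun x => max (f x) 0) x -
        RuelleR Adj φ (fun x => max (-f x) 0) x := fun x => by
      conv_lhs => rw [hdecomp]
      exact ruelleR_sub hpc hmc x
    have hI : ∫ x, f x ∂μ = ∫ x, max (f x) 0 ∂μ - ∫ x, max (-f x) 0 ∂μ := by
      rw [← integral_sub (hint hp hpc) (hint hm hmc)]
      exact integral_congr_ae (Eventually.of_forall fun x => congrFun hdecomp x)
    simp_rw [hR]
    rw [integral_sub (hint (continuous_ruelleR hvar hp hpc) (hasCompactSupport_ruelleR hloc hpc))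
      (hint (continuous_ruelleR hvar hm hmc) (hasCompactSupport_ruelleR hloc hmc)),
      hconf _ hp hpc fun x => le_max_right _ _, hconf _ hm hmc fun x => le_max_right _ _, hI,
      mul_sub]
end
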